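/- Let A = Λ(x,y) with deg x = 2, deg y = 2m+1, and consider SPⁿ(A) = Λ([x],…,[xⁿ],[y],…,[x^{n−1}y]). Then the elements [x^{m+1}], [x^{m+2}], …, [x^{m+n}] form a regular sequence in the polynomial algebra ℚ[[x],[x²],…,[xⁿ]]. -/

import Mathlib

open MvPolynomial

namespace PowerSumRegular

/-- ideal generated by the first `j` members of a sequence -/
def initIdeal {R : Type*} [CommRing R] (f : ℕ → R) (j : ℕ) : Ideal R :=
  Ideal.span (f '' Set.Iio j)

lemma initIdeal_zero {R : Type*} [CommRing R] (f : ℕ → R) : initIdeal f 0 = ⊥ := by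
  simp [initIdeal]

lemma initIdeal_succ {R : Type*} [CommRing R] (f : ℕ → R) (j : ℕ) :
    initIdeal f (j + 1) = initIdeal f j ⊔ Ideal.span {f j} := by
  have : Set.Iio (j + 1) = Set.Iio j ∪ {j} := by
    ext k; simp only [Set.mem_Iio, Set.mem_union, Set.mem_singleton_iff]; omega
  rw [initIdeal, this, Set.image_union, Ideal.span_union, Set.image_singleton]
  rfl

lemma map_initIdeal {R S : Type*} [CommRing R] [CommRing S] (φ : R →+* S) (f : ℕ → R) (j : ℕ) :
    (initIdeal f j).map φ = initIdeal (fun k => φ (f k)) j := by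
  rw [initIdeal, Ideal.map_span, initIdeal, Set.image_image]

/-- `a` is a nonzerodivisor modulo `I` -/
def NzdMod {R : Type*} [CommRing R] (a : R) (I : Ideal R) : Prop := ∀ x, a * x ∈ I → x ∈ I

lemma NzdMod.mul {R : Type*} [CommRing R] {a b : R} {I : Ideal R} (ha : NzdMod a I)
    (hb : NzdMod b I) : NzdMod (a * b) I := fun x hx =>
  hb _ (ha _ (by rwa [← mul_assoc]))

lemma NzdMod.one {R : Type*} [CommRing R] {I : Ideal R} : NzdMod (1 : R) I := fun x hx => by
  simpa using hx

lemma NzdMod.pow {R : Type*} [CommRing R] {a : R} {I : Ideal R} (ha : NzdMod a I) (k : ℕ) :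
    NzdMod (a ^ k) I := by
  induction k with
  | zero => simpa using NzdMod.one
  | succ k ih => rw [pow_succ]; exact ih.mul ha

lemma NzdMod.prod {R ι : Type*} [CommRing R] {I : Ideal R} (s : Finset ι) (a : ι → R)
    (ha : ∀ i, NzdMod (a i) I) : NzdMod (∏ i ∈ s, a i) I := by
  classical
  induction s using Finset.induction_on with
  | empty => simpa using NzdMod.one
  | insert i s hi ih => rw [Finset.prod_insert hi]; exact (ha i).mul ih

/-- separatedness of homogeneous ideals -/
lemma mem_of_forall_pow {σ : Type*} {I : Ideal (MvPolynomial σ ℚ)}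
    (hI : ∀ p ∈ I, ∀ d, homogeneousComponent d p ∈ I)
    {l : MvPolynomial σ ℚ} (hl : l.IsHomogeneous 1) {x : MvPolynomial σ ℚ}
    (hx : ∀ N : ℕ, ∃ y, x - l ^ N * y ∈ I) : x ∈ I := by
  rw [← sum_homogeneousComponent x]
  refine Ideal.sum_mem _ fun d _ => ?_
  obtain ⟨y, hy⟩ := hx (d + 1)
  have h1 := hI _ hy d
  rw [map_sub] at h1
  have h2 : homogeneousComponent d (l ^ (d + 1) * y) = 0 := by
    have hlp : (l ^ (d + 1)).IsHomogeneous (d + 1) := by simpa using hl.pow (d + 1)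
    rw [← sum_homogeneousComponent y, Finset.mul_sum, map_sum]
    refine Finset.sum_eq_zero fun i _ => ?_
    rw [homogeneousComponent_of_mem (n := d + 1 + i)
      (hlp.mul (homogeneousComponent_isHomogeneous i y))]
    rw [if_neg (by omega)]
  rwa [h2, sub_zero] at h1

lemma initIdeal_hom {σ : Type*} (f : ℕ → MvPolynomial σ ℚ) (e : ℕ → ℕ)
    (hf : ∀ k, (f k).IsHomogeneous (e k)) (j : ℕ) :
    ∀ p ∈ initIdeal f j, ∀ d, homogeneousComponent d p ∈ initIdeal f j := by
  intro p hp d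
  let _ := MvPolynomial.gradedAlgebra (σ := σ) (R := ℚ)
  refine homogeneousComponent_mem_of_mem (Ideal.homogeneous_span _ _ ?_) hp d
  rintro _ ⟨k, _, rfl⟩
  exact ⟨e k, hf k⟩

/-- moving a linear form past a sequence -/
lemma swap {σ : Type*} (f : ℕ → MvPolynomial σ ℚ) (e : ℕ → ℕ)
    (hf : ∀ k, (f k).IsHomogeneous (e k)) {l : MvPolynomial σ ℚ} (hl : l.IsHomogeneous 1)
    (hl0 : l ≠ 0) (n : ℕ)
    (h : ∀ j < n, NzdMod (f j) (initIdeal f j ⊔ Ideal.span {l})) :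
    ∀ j ≤ n, NzdMod l (initIdeal f j) ∧ (j < n → NzdMod (f j) (initIdeal f j)) := by
  have key : ∀ j < n, NzdMod l (initIdeal f j) → NzdMod (f j) (initIdeal f j) := by
    intro j hj hlj x hx
    have step : ∀ x, f j * x ∈ initIdeal f j →
        ∃ y, f j * y ∈ initIdeal f j ∧ x - l * y ∈ initIdeal f j := by
      intro x hx
      have h1 := h j hj x (Ideal.mem_sup_left hx)
      obtain ⟨i, hi, z, hz, rfl⟩ := Submodule.mem_sup.1 h1
      obtain ⟨y, rfl⟩ := Ideal.mem_span_singleton'.1 hz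
      refine ⟨y, hlj _ ?_, ?_⟩
      · have : l * (f j * y) = f j * (i + y * l) - f j * i := by ring
        rw [this]
        exact sub_mem hx (Ideal.mul_mem_left _ _ hi)
      · have : i + y * l - l * y = i := by ring
        rwa [this]
    have hN : ∀ N : ℕ, ∃ y, f j * y ∈ initIdeal f j ∧ x - l ^ N * y ∈ initIdeal f j := by
      intro N
      induction N with
      | zero => exact ⟨x, hx, by simp⟩
      | succ N ih =>
        obtain ⟨y, hy, hy'⟩ := ih
        obtain ⟨z, hz, hz'⟩ := step y hy
        refine ⟨z, hz, ?_⟩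
        have : x - l ^ (N + 1) * z = (x - l ^ N * y) + l ^ N * (y - l * z) := by ring
        rw [this]
        exact add_mem hy' (Ideal.mul_mem_left _ _ hz')
    exact mem_of_forall_pow (initIdeal_hom f e hf j) hl fun N => (hN N).imp fun _ h => h.2
  have main : ∀ j ≤ n, NzdMod l (initIdeal f j) := by
    intro j
    induction j with
    | zero =>
      intro _ x hx
      rw [initIdeal_zero] at hx ⊢
      simpa [hl0] using hx
    | succ j ih =>
      intro hj x hx
      have hlj := ih (by omega)
      rw [initIdeal_succ] at hx ⊢
      obtain ⟨i, hi, z, hz, hiz⟩ := Submodule.mem_sup.1 hx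
      obtain ⟨y, rfl⟩ := Ideal.mem_span_singleton'.1 hz
      have h1 : f j * y ∈ initIdeal f j ⊔ Ideal.span {l} := by
        have : f j * y = -i + x * l := by linear_combination hiz
        rw [this]
        exact add_mem (Ideal.mem_sup_left (neg_mem hi))
          (Ideal.mem_sup_right (Ideal.mem_span_singleton'.2 ⟨x, rfl⟩))
      obtain ⟨i', hi', z, hz', rfl⟩ := Submodule.mem_sup.1 (h j (by omega) y h1)
      obtain ⟨w, rfl⟩ := Ideal.mem_span_singleton'.1 hz'
      have h2 : x - f j * w ∈ initIdeal f j := by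
        apply hlj
        have : l * (x - f j * w) = i + f j * i' := by linear_combination -hiz
        rw [this]
        exact add_mem hi (Ideal.mul_mem_left _ _ hi')
      have : x = (x - f j * w) + w * f j := by ring
      rw [this]
      exact add_mem (Ideal.mem_sup_left h2)
        (Ideal.mem_sup_right (Ideal.mem_span_singleton'.2 ⟨w, rfl⟩))
  exact fun j hj => ⟨main j hj, fun hj' => key j hj' (main j hj)⟩

/-- weighted power sums -/
noncomputable def wp {n : ℕ} (c : Fin n → ℚ) (m k : ℕ) : MvPolynomial (Fin n) ℚ :=
  ∑ i, C (c i) * X i ^ (m + 1 + k)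

lemma wp_hom {n : ℕ} (c : Fin n → ℚ) (m k : ℕ) : (wp c m k).IsHomogeneous (m + 1 + k) := by
  refine IsHomogeneous.sum _ _ _ fun i _ => ?_
  simpa using (isHomogeneous_C _ (c i)).mul ((isHomogeneous_X ℚ i).pow (m + 1 + k))

/-- substitute `v` for the first variable -/
noncomputable def sb {n : ℕ} (v : MvPolynomial (Fin n) ℚ) :
    MvPolynomial (Fin (n + 1)) ℚ →ₐ[ℚ] MvPolynomial (Fin n) ℚ :=
  aeval (Fin.cons v X)

lemma sb_rename {n : ℕ} (v p : MvPolynomial (Fin n) ℚ) : sb v (rename Fin.succ p) = p := by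
  rw [sb, aeval_rename]
  have : (Fin.cons v X : Fin (n + 1) → MvPolynomial (Fin n) ℚ) ∘ Fin.succ = X := by
    ext1 i; simp
  rw [this]; simp

lemma sb_surj {n : ℕ} (v : MvPolynomial (Fin n) ℚ) : Function.Surjective (sb v) :=
  fun p => ⟨_, sb_rename v p⟩

lemma sub_mem_span {n : ℕ} (v : MvPolynomial (Fin n) ℚ) (p : MvPolynomial (Fin (n + 1)) ℚ) :
    p - rename Fin.succ (sb v p) ∈ Ideal.span {X 0 - rename Fin.succ v} := by
  induction p using MvPolynomial.induction_on with
  | C a => simp [sb]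
  | add p q hp hq =>
    have := add_mem hp hq
    simp only [map_add]
    convert this using 1
    ring
  | mul_X p i hp =>
    have hi : X i - rename Fin.succ (sb v (X i)) ∈
        Ideal.span {(X 0 : MvPolynomial (Fin (n + 1)) ℚ) - rename Fin.succ v} := by
      refine Fin.cases ?_ (fun i => ?_) i
      · simpa [sb] using Ideal.subset_span (Set.mem_singleton _)
      · simp [sb]
    have h1 := add_mem (Ideal.mul_mem_right (X i) _ hp)
      (Ideal.mul_mem_left _ (rename Fin.succ (sb v p)) hi)
    simp only [map_mul]
    convert h1 using 1
    ring

lemma ker_sb {n : ℕ} (v : MvPolynomial (Fin n) ℚ) :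
    Ideal.comap (sb v : MvPolynomial (Fin (n + 1)) ℚ →+* MvPolynomial (Fin n) ℚ) ⊥ =
      Ideal.span {X 0 - rename Fin.succ v} := by
  apply le_antisymm
  · intro p hp
    have hp' : sb v p = 0 := by simpa using hp
    have := sub_mem_span v p
    rwa [hp', map_zero, sub_zero] at this
  · rw [Ideal.span_singleton_le_iff_mem]
    have : sb v (X 0 - rename Fin.succ v) = 0 := by
      rw [map_sub, sb_rename]; simp [sb]
    simpa using this

lemma nzd_lift {n : ℕ} (v : MvPolynomial (Fin n) ℚ) (f : ℕ → MvPolynomial (Fin (n + 1)) ℚ)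
    (g : ℕ → MvPolynomial (Fin n) ℚ) (hg : ∀ k, sb v (f k) = g k) (j : ℕ)
    (h : NzdMod (g j) (initIdeal g j)) :
    NzdMod (f j) (initIdeal f j ⊔ Ideal.span {X 0 - rename Fin.succ v}) := by
  have hfg : (fun k => (sb v : MvPolynomial (Fin (n + 1)) ℚ →+* MvPolynomial (Fin n) ℚ) (f k)) = g := funext hg
  have e : initIdeal f j ⊔ Ideal.span {X 0 - rename Fin.succ v} =
      Ideal.comap (sb v : MvPolynomial (Fin (n + 1)) ℚ →+* MvPolynomial (Fin n) ℚ) (initIdeal g j) := by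
    rw [← ker_sb, ← Ideal.comap_map_of_surjective
      (sb v : MvPolynomial (Fin (n + 1)) ℚ →+* MvPolynomial (Fin n) ℚ) (sb_surj v), map_initIdeal, hfg]
  rw [e]
  intro x hx
  rw [Ideal.mem_comap, map_mul] at hx
  rw [Ideal.mem_comap]
  apply h
  rw [← hg j]
  exact hx

lemma sb_wp {n : ℕ} (c : Fin (n + 1) → ℚ) (m k : ℕ) (v : MvPolynomial (Fin n) ℚ) :
    sb v (wp c m k) = C (c 0) * v ^ (m + 1 + k) + wp (fun i => c i.succ) m k := by
  simp [wp, sb, Fin.sum_univ_succ, algebraMap_eq]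

lemma last_congr {n : ℕ} (c : Fin (n + 1) → ℚ) (m : ℕ) :
    wp c m n - C (c 0) * X 0 ^ (m + 1) * ∏ l : Fin n, (X 0 - X l.succ) ∈
      initIdeal (wp c m) n := by
  set P : Polynomial (MvPolynomial (Fin (n + 1)) ℚ) :=
    ∏ l : Fin n, (Polynomial.X - Polynomial.C (X l.succ)) with hP
  have hmon : P.Monic := Polynomial.monic_prod_of_monic _ _ fun l _ => Polynomial.monic_X_sub_C _
  have hdeg : P.natDegree = n := by
    rw [hP, Polynomial.natDegree_prod_of_monic _ _ fun l _ => Polynomial.monic_X_sub_C _]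
    simp
  have hev : ∀ t, P.eval t = ∏ l : Fin n, (t - X l.succ) := by
    intro t; simp [hP, Polynomial.eval_prod]
  have hsum : ∑ i, C (c i) * X i ^ (m + 1) * P.eval (X i) =
      C (c 0) * X 0 ^ (m + 1) * ∏ l : Fin n, (X 0 - X l.succ) := by
    rw [Fin.sum_univ_succ, hev, Finset.sum_eq_zero, add_zero]
    intro i _
    rw [hev, Finset.prod_eq_zero (Finset.mem_univ i) (sub_self _), mul_zero]
  have hexp : ∑ i, C (c i) * X i ^ (m + 1) * P.eval (X i) =
      ∑ k ∈ Finset.range (n + 1), P.coeff k * wp c m k := by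
    simp only [Polynomial.eval_eq_sum_range, hdeg, wp, Finset.mul_sum]
    rw [Finset.sum_comm]
    refine Finset.sum_congr rfl fun k _ => Finset.sum_congr rfl fun i _ => ?_
    ring
  have hc : P.coeff n = 1 := by
    have := hmon.coeff_natDegree
    rwa [hdeg] at this
  rw [← hsum, hexp, Finset.sum_range_succ, hc]
  have : wp c m n - (∑ k ∈ Finset.range n, P.coeff k * wp c m k + 1 * wp c m n) =
    - ∑ k ∈ Finset.range n, P.coeff k * wp c m k := by ring
  rw [this]
  refine neg_mem (Ideal.sum_mem _ fun k hk => Ideal.mul_mem_left _ _ (Ideal.subset_span ?_))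
  exact ⟨k, by simpa using hk, rfl⟩

lemma NzdMod.congr {R : Type*} [CommRing R] {a b : R} {I : Ideal R} (hb : NzdMod b I)
    (h : a - b ∈ I) : NzdMod a I := fun x hx => hb x (by
  have : b * x = a * x - (a - b) * x := by ring
  rw [this]
  exact sub_mem hx (Ideal.mul_mem_right _ _ h))

theorem wp_regular (m n : ℕ) : ∀ (c : Fin n → ℚ), (∀ i, 0 < c i) → ∀ j < n,
    NzdMod (wp c m j) (initIdeal (wp c m) j) := by
  induction n with
  | zero => intro c _ j hj; omega
  | succ n ih =>
    intro c hc
    have base : ∀ (v : MvPolynomial (Fin n) ℚ) (c' : Fin n → ℚ), (∀ i, 0 < c' i) →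
        (∀ k, sb v (wp c m k) = wp c' m k) →
        (X 0 - rename Fin.succ v : MvPolynomial (Fin (n + 1)) ℚ).IsHomogeneous 1 →
        (X 0 - rename Fin.succ v : MvPolynomial (Fin (n + 1)) ℚ) ≠ 0 →
        ∀ j ≤ n, NzdMod (X 0 - rename Fin.succ v) (initIdeal (wp c m) j) ∧
          (j < n → NzdMod (wp c m j) (initIdeal (wp c m) j)) := by
      intro v c' hc' hv hh h0
      exact swap (wp c m) _ (wp_hom c m) hh h0 n fun j hj =>
        nzd_lift v _ _ hv j (ih c' hc' j hj)
    have h0 := base 0 (fun i => c i.succ) (fun i => hc _)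
      (fun k => by rw [sb_wp]; simp) (by simpa using isHomogeneous_X ℚ 0) (by simp)
    have hl : ∀ l : Fin n, NzdMod (X 0 - X l.succ) (initIdeal (wp c m) n) := by
      intro l
      have := base (X l) (fun i => c i.succ + if i = l then c 0 else 0)
        (fun i => by
          have h1 := hc i.succ
          have h2 := hc 0
          split_ifs <;> linarith)
        (fun k => by
          rw [sb_wp]
          simp only [wp, map_add, add_mul, Finset.sum_add_distrib]
          rw [add_comm]
          congr 1
          rw [Finset.sum_eq_single l] <;> simp +contextual)
        (by simpa using (isHomogeneous_X ℚ (0 : Fin (n + 1))).sub (isHomogeneous_X ℚ l.succ))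
        (by
          rw [rename_X, sub_ne_zero]
          intro h
          exact (Fin.succ_ne_zero l) (X_injective h).symm)
        n le_rfl
      simpa using this.1
    intro j hj
    rcases Nat.lt_succ_iff_lt_or_eq.1 hj with hj | rfl
    · exact (h0 j hj.le).2 hj
    · refine NzdMod.congr ?_ (last_congr c m)
      refine NzdMod.mul (NzdMod.mul ?_ (NzdMod.pow ?_ _)) (NzdMod.prod _ _ hl)
      · intro x hx
        have := Ideal.mul_mem_left _ (C (c 0)⁻¹) hx
        rwa [← mul_assoc, ← C_mul, inv_mul_cancel₀ (hc 0).ne', C_1, one_mul] at this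
      · simpa using (h0 j le_rfl).1

/-- symmetrization -/
noncomputable def symm0 {n : ℕ} (p : MvPolynomial (Fin n) ℚ) : MvPolynomial (Fin n) ℚ :=
  C ((Fintype.card (Equiv.Perm (Fin n)) : ℚ)⁻¹) * ∑ s : Equiv.Perm (Fin n), rename s p

lemma symm0_mem {n : ℕ} (p : MvPolynomial (Fin n) ℚ) :
    symm0 p ∈ symmetricSubalgebra (Fin n) ℚ := by
  rw [mem_symmetricSubalgebra]
  intro t
  rw [symm0, map_mul, rename_C, map_sum]
  congr 1
  refine Fintype.sum_equiv (Equiv.mulLeft t) _ _ fun s => ?_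
  rw [rename_rename]
  rfl

lemma symm0_mul {n : ℕ} (p q : MvPolynomial (Fin n) ℚ) (hq : q.IsSymmetric) :
    symm0 (p * q) = symm0 p * q := by
  simp only [symm0, map_mul, hq _, ← Finset.sum_mul]
  ring

lemma symm0_self {n : ℕ} (q : MvPolynomial (Fin n) ℚ) (hq : q.IsSymmetric) :
    symm0 q = q := by
  simp only [symm0, hq _, Finset.sum_const, Finset.card_univ, nsmul_eq_mul, ← mul_assoc]
  rw [← map_natCast (C : ℚ →+* MvPolynomial (Fin n) ℚ), ← C_mul, inv_mul_cancel₀, C_1, one_mul]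
  exact_mod_cast Fintype.card_ne_zero

lemma symm0_add {n : ℕ} (p q : MvPolynomial (Fin n) ℚ) :
    symm0 (p + q) = symm0 p + symm0 q := by
  simp only [symm0, map_add, Finset.sum_add_distrib, mul_add]

lemma descend {n : ℕ} (J : Ideal (symmetricSubalgebra (Fin n) ℚ))
    (p : MvPolynomial (Fin n) ℚ)
    (hp : p ∈ J.map (algebraMap (symmetricSubalgebra (Fin n) ℚ) (MvPolynomial (Fin n) ℚ))) :
    (⟨symm0 p, symm0_mem p⟩ : symmetricSubalgebra (Fin n) ℚ) ∈ J := by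
  have key : ∀ r : MvPolynomial (Fin n) ℚ,
      (⟨symm0 (r * p), symm0_mem _⟩ : symmetricSubalgebra (Fin n) ℚ) ∈ J := by
    rw [Ideal.map] at hp
    induction hp using Submodule.span_induction with
    | mem x hx =>
      obtain ⟨y, hy, rfl⟩ := hx
      intro r
      have : (⟨symm0 (r * (y : MvPolynomial (Fin n) ℚ)), symm0_mem _⟩ :
          symmetricSubalgebra (Fin n) ℚ) = ⟨symm0 r, symm0_mem r⟩ * y :=
        Subtype.ext (symm0_mul _ _ ((mem_symmetricSubalgebra _).1 y.2))
      exact this ▸ J.mul_mem_left _ hy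
    | zero =>
      intro r
      convert J.zero_mem using 1
      exact Subtype.ext (by simp [symm0])
    | add x y _ _ hx hy =>
      intro r
      convert J.add_mem (hx r) (hy r) using 1
      exact Subtype.ext ((congrArg symm0 (mul_add r x y)).trans (symm0_add _ _))
    | smul a x _ hx =>
      intro r
      convert hx (r * a) using 3
      rw [smul_eq_mul, mul_assoc]
  simpa using key 1

lemma wp_one (n m k : ℕ) : wp (fun _ : Fin n => (1 : ℚ)) m k = psum (Fin n) ℚ (m + 1 + k) := by
  simp [wp, psum]

end PowerSumRegular

/-- the power sums `[x^{m+1}], …, [x^{m+n}]` form a regular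
sequence in `ℚ[[x],…,[xⁿ]] = ℚ[x₁,…,xₙ]^{Σₙ}`, the symmetric subalgebra. -/
theorem stmt19 (n m : ℕ) (hn : 1 ≤ n) (hm : 1 ≤ m) :
    RingTheory.Sequence.IsRegular (MvPolynomial.symmetricSubalgebra (Fin n) ℚ)
      (List.ofFn fun j : Fin n =>
        (⟨MvPolynomial.psum (Fin n) ℚ (m + 1 + (j : ℕ)),
            (MvPolynomial.mem_symmetricSubalgebra _).mpr
              (MvPolynomial.psum_isSymmetric (Fin n) ℚ _)⟩ :
          MvPolynomial.symmetricSubalgebra (Fin n) ℚ)) := by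
  set L := (List.ofFn fun j : Fin n =>
        (⟨MvPolynomial.psum (Fin n) ℚ (m + 1 + (j : ℕ)),
            (MvPolynomial.mem_symmetricSubalgebra _).mpr
              (MvPolynomial.psum_isSymmetric (Fin n) ℚ _)⟩ :
          MvPolynomial.symmetricSubalgebra (Fin n) ℚ)) with hL
  have hmap : ∀ i, (Ideal.ofList (L.take i)).map
      (algebraMap (symmetricSubalgebra (Fin n) ℚ) (MvPolynomial (Fin n) ℚ)) ≤
      PowerSumRegular.initIdeal (PowerSumRegular.wp (fun _ : Fin n => (1 : ℚ)) m) i := by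
    intro i
    rw [Ideal.map_le_iff_le_comap, Ideal.span_le]
    intro r hr
    obtain ⟨k, hk, rfl⟩ := List.mem_take_iff_getElem.1 hr
    refine Ideal.subset_span ⟨k, ?_, ?_⟩
    · simp only [Set.mem_Iio]; omega
    · rw [PowerSumRegular.wp_one]
      simp [hL]
  have hmap' : ∀ i ≤ n, PowerSumRegular.initIdeal
      (PowerSumRegular.wp (fun _ : Fin n => (1 : ℚ)) m) i ≤ (Ideal.ofList (L.take i)).map
      (algebraMap (symmetricSubalgebra (Fin n) ℚ) (MvPolynomial (Fin n) ℚ)) := by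
    intro i hi
    rw [PowerSumRegular.initIdeal, Ideal.span_le]
    rintro _ ⟨k, hk, rfl⟩
    have hk' : k < i := hk
    rw [PowerSumRegular.wp_one]
    refine Ideal.mem_map_of_mem (algebraMap (symmetricSubalgebra (Fin n) ℚ)
      (MvPolynomial (Fin n) ℚ))
      (x := ⟨psum (Fin n) ℚ (m + 1 + k), (MvPolynomial.mem_symmetricSubalgebra _).mpr
              (MvPolynomial.psum_isSymmetric (Fin n) ℚ _)⟩) (Ideal.subset_span ?_)
    refine List.mem_take_iff_getElem.2 ⟨k, ?_, ?_⟩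
    · simp [hL]; omega
    · simp [hL]
  refine ⟨⟨fun i hi => ?_⟩, ?_⟩
  · have hin : i < n := by simpa [hL] using hi
    rw [isSMulRegular_quotient_iff_mem_of_smul_mem]
    intro x hx
    rw [smul_eq_mul, Ideal.mul_top] at hx ⊢
    have h1 := hmap i (Ideal.mem_map_of_mem _ hx)
    rw [smul_eq_mul, map_mul] at h1
    have h2 : algebraMap (symmetricSubalgebra (Fin n) ℚ) (MvPolynomial (Fin n) ℚ) L[i] =
        PowerSumRegular.wp (fun _ : Fin n => (1 : ℚ)) m i := by
      rw [PowerSumRegular.wp_one]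
      simp [hL]
    rw [h2] at h1
    have h3 := PowerSumRegular.descend _ _ (hmap' i hin.le
      (PowerSumRegular.wp_regular m n _ (fun _ => one_pos) i hin _ h1))
    convert h3 using 1
    exact Subtype.ext (PowerSumRegular.symm0_self _ ((mem_symmetricSubalgebra _).1 x.2)).symm
  · intro h
    rw [smul_eq_mul, Ideal.mul_top] at h
    have h1 : (1 : symmetricSubalgebra (Fin n) ℚ) ∈ Ideal.ofList L := h ▸ Submodule.mem_top
    have h2 : Ideal.ofList L ≤ RingHom.ker ((constantCoeff (σ := Fin n) (R := ℚ)).comp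
        (algebraMap (symmetricSubalgebra (Fin n) ℚ) (MvPolynomial (Fin n) ℚ))) := by
      rw [Ideal.span_le]
      intro r hr
      obtain ⟨k, rfl⟩ := (List.mem_ofFn' _ _).1 hr
      change constantCoeff (psum (Fin n) ℚ (m + 1 + (k : ℕ))) = 0
      simp [psum]
    have h3 := h2 h1
    rw [RingHom.mem_ker, map_one] at h3
    exact one_ne_zero h3
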